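/- Let 1 < β ≤ 2. Then the family (ĝ_k^{(β)})_{k∈ℤ} is absolutely summable and Σ_{k∈ℤ} |ĝ_k^{(β)}| = 2·ĝ₀^{(β)} < ∞; in particular the generating function p(θ) = Σ_{k∈ℤ} ĝ_k^{(β)}·e^{ikθ} has absolutely summable Fourier coefficients (it is in the Wiener class). -/

import Mathlib

/-- Fractional centered difference coefficients `ĝ_k^{(β)}`. -/
noncomputable def ghat (β : ℝ) (k : ℤ) : ℝ :=
  (-1 : ℝ) ^ k * Real.Gamma (β + 1) /
    (Real.Gamma (β / 2 - k + 1) * Real.Gamma (β / 2 + k + 1))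

/-- The `(M−1)×(M−1)` symmetric Toeplitz matrix `G_β`. -/
noncomputable def Gmat (β : ℝ) (M : ℕ) : Matrix (Fin (M - 1)) (Fin (M - 1)) ℝ :=
  Matrix.of fun i j => ghat β ((i : ℤ) - (j : ℤ))

/-- First column of the circulant approximation `r(G_β)`. -/
noncomputable def rcol (β : ℝ) (M : ℕ) (k : ℕ) : ℝ :=
  if k = 0 then ghat β 0 else ghat β k + ghat β ((k : ℤ) - ((M : ℤ) - 1))

/-- The `(M−1)×(M−1)` circulant matrix `r(G_β)`. -/
noncomputable def circG (β : ℝ) (M : ℕ) : Matrix (Fin (M - 1)) (Fin (M - 1)) ℝ :=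
  Matrix.of fun i j => rcol β M ((((i : ℤ) - (j : ℤ)) % ((M : ℤ) - 1)).toNat)

/-- The constant `c_*^{(β)} = (2/β) r_β`. -/
noncomputable def cstar (β : ℝ) : ℝ :=
  (2 / β) * (Real.exp (-2) * ((4 - β) * (2 - β) * β) / ((6 + β) * (4 + β) * (2 + β)) *
    (Real.Gamma (β + 1) / (Real.Gamma (β / 2 + 1)) ^ 2) * (3 + β / 2) ^ (β + 1))

/-- Grünwald coefficients `g_k^{(γ)}`. -/
noncomputable def gcoef (γ : ℝ) : ℕ → ℝ
  | 0 => 1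
  | (k + 1) => (1 - (γ + 1) / (k + 1)) * gcoef γ k

/-- Weighted and shifted Grünwald coefficients `λ_k^{(γ)}`. -/
noncomputable def lamc (γ : ℝ) : ℕ → ℝ
  | 0 => 1 + γ / 2
  | (k + 1) => (1 + γ / 2) * gcoef γ (k + 1) - (γ / 2) * gcoef γ k

theorem ghat_rec (β : ℝ) (hβ1 : 1 < β) (k : ℕ) :
    (k + 1 + β / 2) * ghat β ((k : ℤ) + 1) = (k - β / 2) * ghat β k := by
  have hk : (0 : ℝ) ≤ k := Nat.cast_nonneg k
  have h1 : Real.Gamma (β / 2 + k + 1 + 1) = (β / 2 + k + 1) * Real.Gamma (β / 2 + k + 1) :=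
    Real.Gamma_add_one (by positivity)
  have hp : Real.Gamma (β / 2 + k + 1) ≠ 0 := (Real.Gamma_pos_of_pos (by positivity)).ne'
  have hq : β / 2 + k + 1 ≠ 0 := by positivity
  have h2 : (Real.Gamma (β / 2 - k))⁻¹ = (β / 2 - k) * (Real.Gamma (β / 2 - k + 1))⁻¹ := by
    by_cases h : β / 2 - k = 0
    · rw [h]; simp [Real.Gamma_zero]
    · rw [Real.Gamma_add_one h, mul_inv, mul_inv_cancel_left₀ h]
  unfold ghat
  have e1 : β / 2 - (((k : ℤ) + 1 : ℤ) : ℝ) + 1 = β / 2 - k := by push_cast; ring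
  have e2 : β / 2 + (((k : ℤ) + 1 : ℤ) : ℝ) + 1 = β / 2 + k + 1 + 1 := by push_cast; ring
  rw [e1, e2, h1, zpow_add_one₀ (by norm_num)]
  simp only [Int.cast_natCast, div_eq_mul_inv _ (_ * _), mul_inv, h2]
  field_simp
  ring

theorem ghat_neg (β : ℝ) (k : ℤ) : ghat β (-k) = ghat β k := by
  unfold ghat
  have : (-1 : ℝ) ^ (-k) = (-1) ^ k := by
    rw [zpow_neg, ← inv_zpow]; norm_num
  rw [this, mul_comm (Real.Gamma _)]
  push_cast
  simp only [sub_neg_eq_add, ← sub_eq_add_neg]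

theorem ghat_zero_pos (β : ℝ) (hβ1 : 1 < β) : 0 < ghat β 0 := by
  unfold ghat
  have h1 := Real.Gamma_pos_of_pos (s := β + 1) (by linarith)
  have h2 := Real.Gamma_pos_of_pos (s := β / 2 + 1) (by linarith)
  simp
  positivity

theorem ghat_succ_nonpos (β : ℝ) (hβ1 : 1 < β) (hβ2 : β ≤ 2) (k : ℕ) :
    ghat β ((k : ℤ) + 1) ≤ 0 := by
  induction k with
  | zero =>
    have h := ghat_rec β hβ1 0
    have h0 := ghat_zero_pos β hβ1
    simp only [Nat.cast_zero, zero_add, zero_sub] at h ⊢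
    by_contra! hc
    have : 0 < (1 + β / 2) * ghat β 1 := by positivity
    nlinarith
  | succ k ih =>
    have h := ghat_rec β hβ1 (k + 1)
    push_cast at h ⊢
    have hk : (0 : ℝ) ≤ k := Nat.cast_nonneg k
    by_contra! hc
    have : 0 < ((k : ℝ) + 1 + 1 + β / 2) * ghat β ((k : ℤ) + 1 + 1) := by positivity
    have : ((k : ℝ) + 1 - β / 2) * ghat β ((k : ℤ) + 1) ≤ 0 :=
      mul_nonpos_of_nonneg_of_nonpos (by linarith) ih
    linarith

theorem ghat_hasSum (β : ℝ) (hβ1 : 1 < β) (hβ2 : β ≤ 2) :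
    HasSum (fun n : ℕ => |ghat β ((n : ℤ) + 1)|) (ghat β 0 / 2) := by
  set u : ℕ → ℝ := fun n => - ghat β ((n : ℤ) + 1) with hu
  have hu0 : ∀ n, 0 ≤ u n := fun n => neg_nonneg.2 (ghat_succ_nonpos β hβ1 hβ2 n)
  have habs : (fun n : ℕ => |ghat β ((n : ℤ) + 1)|) = u := by
    funext n
    exact abs_of_nonpos (ghat_succ_nonpos β hβ1 hβ2 n)
  rw [habs]
  set B : ℕ → ℝ := fun n => ((n : ℝ) - β / 2) * (- ghat β n) with hB
  have hBs : ∀ n, B (n + 1) = ((n : ℝ) + 1 - β / 2) * u n := by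
    intro n; simp [hB, hu]
  have hBd : ∀ n, β * u n = B n - B (n + 1) := by
    intro n
    rw [hBs]
    have := ghat_rec β hβ1 n
    simp only [hB, hu]
    linarith
  have hsum : ∀ n, ∑ i ∈ Finset.range n, u i = (B 0 - B n) / β := by
    intro n
    rw [eq_div_iff (by linarith), mul_comm, Finset.mul_sum, ← Finset.sum_range_sub' B n]
    exact Finset.sum_congr rfl fun i _ => hBd i
  have hg0 := ghat_zero_pos β hβ1
  have hB0 : B 0 = β / 2 * ghat β 0 := by simp [hB]
  have hBnn : ∀ n, 0 ≤ B n := by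
    intro n
    cases n with
    | zero => rw [hB0]; positivity
    | succ n =>
      rw [hBs]
      have hk : (0 : ℝ) ≤ n := Nat.cast_nonneg n
      exact mul_nonneg (by linarith) (hu0 n)
  have hanti : Antitone B := antitone_nat_of_succ_le fun n => by
    have := hBd n
    have : 0 ≤ β * u n := mul_nonneg (by linarith) (hu0 n)
    linarith
  have hsm : Summable u := by
    refine summable_of_sum_range_le (c := B 0 / β) hu0 fun n => ?_
    rw [hsum]
    have := hBnn n
    gcongr
    linarith
  have hbdd : BddBelow (Set.range B) := ⟨0, by rintro _ ⟨n, rfl⟩; exact hBnn n⟩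
  have hlim := tendsto_atTop_ciInf hanti hbdd
  set L := ⨅ i, B i with hL
  have hL0 : 0 ≤ L := le_ciInf hBnn
  have hLz : L = 0 := by
    by_contra hne
    have hLp : 0 < L := lt_of_le_of_ne hL0 (Ne.symm hne)
    have h1 : Summable fun n : ℕ => L * (1 / ((n : ℝ) + 1)) := by
      refine Summable.of_nonneg_of_le (fun n => by positivity) (fun n => ?_) hsm
      have h2 : L ≤ B (n + 1) := ciInf_le hbdd _
      rw [hBs] at h2
      rw [mul_one_div, div_le_iff₀ (by positivity)]
      nlinarith [hu0 n]
    rw [summable_mul_left_iff hne] at h1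
    have h3 : Summable fun n : ℕ => 1 / (n : ℝ) := by
      rw [← summable_nat_add_iff 1]
      simpa using h1
    exact Real.not_summable_one_div_natCast h3
  rw [hLz] at hlim
  rw [hsm.hasSum_iff_tendsto_nat]
  have h4 : Filter.Tendsto (fun n => (B 0 - B n) / β) Filter.atTop (nhds ((B 0 - 0) / β)) :=
    (tendsto_const_nhds.sub hlim).div_const β
  have h5 : (B 0 - 0) / β = ghat β 0 / 2 := by
    rw [hB0]; field_simp; ring
  rw [h5] at h4
  exact h4.congr fun n => (hsum n).symm

/-- the coefficients `ĝ_k^{(β)}` are absolutely summable with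
`Σ_{k∈ℤ} |ĝ_k^{(β)}| = 2 ĝ₀^{(β)}`; in particular the generating function
`p(θ) = Σ_k ĝ_k^{(β)} e^{ikθ}` has absolutely summable Fourier coefficients. -/
theorem stmt18 (β : ℝ) (hβ1 : 1 < β) (hβ2 : β ≤ 2) :
    (Summable fun k : ℤ => |ghat β k|) ∧
    ∑' k : ℤ, |ghat β k| = 2 * ghat β 0 := by
  have h := ghat_hasSum β hβ1 hβ2
  have hg0 := ghat_zero_pos β hβ1
  have h1 : HasSum (fun n : ℕ => |ghat β (n : ℤ)|) (ghat β 0 / 2 + ghat β 0) := by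
    rw [← hasSum_nat_add_iff' 1]
    simpa [abs_of_pos hg0] using h
  have h2 : HasSum (fun n : ℕ => |ghat β (-((n : ℤ) + 1))|) (ghat β 0 / 2) := by
    simpa only [ghat_neg] using h
  have h3 := HasSum.of_nat_of_neg_add_one (f := fun k : ℤ => |ghat β k|) h1 h2
  refine ⟨h3.summable, ?_⟩
  rw [h3.tsum_eq]
  ring
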